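/- Let d ≥ 2. For any Borel sets A, B ⊆ ℝ^d with finite Lebesgue measures, |A^♮ + B^♮| ≤ |A + B|, where A^♮ = (A^⋆)^* is Steiner symmetrization followed by Schwarz symmetrization (here |·| of a sumset means outer Lebesgue measure). -/

import Mathlib

open MeasureTheory Set Pointwise Filter ENNReal

noncomputable section

abbrev Edim (n : ℕ) := EuclideanSpace ℝ (Fin n)

/-- We identify `ℝ^d` with `ℝ^{d-1} × ℝ`. -/
abbrev Sp (n : ℕ) := Edim n × ℝ

/-- The vertical slice `A_x ⊆ ℝ` of a set `A ⊆ ℝ^{n} × ℝ`. -/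
def vslice {n : ℕ} (A : Set (Sp n)) (x : Edim n) : Set ℝ := {y | (x, y) ∈ A}

/-- The horizontal slice of `A ⊆ ℝ^n × ℝ` at height `t`. -/
def hslice {n : ℕ} (A : Set (Sp n)) (t : ℝ) : Set (Edim n) := {x | (x, t) ∈ A}

/-- Steiner symmetrization `A^⋆`: the slice `(A^⋆)_x` is the open interval
`(-|A_x|/2, |A_x|/2)` centered at `0` of length `|A_x|` (empty if `|A_x| = 0`). -/
def steiner {n : ℕ} (A : Set (Sp n)) : Set (Sp n) :=
  {p | ENNReal.ofReal (2 * |p.2|) < volume (vslice A p.1)}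

/-- Schwarz symmetrization `A^*`: the horizontal slice of `A^*` at height `t` is the open
ball in `ℝ^n` centered at `0` whose measure equals that of the corresponding slice of `A`. -/
def schwarz {n : ℕ} (A : Set (Sp n)) : Set (Sp n) :=
  {p | volume (Metric.ball (0 : Edim n) ‖p.1‖) < volume (hslice A p.2)}

/-- The symmetrization `A^♮ = (A^⋆)^*`. -/
def natSymm {n : ℕ} (A : Set (Sp n)) : Set (Sp n) := schwarz (steiner A)

theorem Real.volume_add_volume_le_volume_add {X Y : Set ℝ} (hX : MeasurableSet X)
    (hY : MeasurableSet Y) (hX0 : X.Nonempty) (hY0 : Y.Nonempty) :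
    volume X + volume Y ≤ volume (X + Y) := by
  have key : ∀ K L : Set ℝ, IsCompact K → IsCompact L → K.Nonempty → L.Nonempty →
      volume K + volume L ≤ volume (K + L) := by
    intro K L hK hL hK0 hL0
    obtain ⟨k, hk, hkmax⟩ := hK.exists_isGreatest hK0
    obtain ⟨l, hl, hlmin⟩ := hL.exists_isLeast hL0
    have hd : AEDisjoint volume (l +ᵥ K) (k +ᵥ L) := by
      refine measure_mono_null (t := {k + l}) ?_ (by simp)
      rintro z ⟨⟨x, hx, rfl⟩, ⟨y, hy, hxy⟩⟩
      have h1 := hkmax hx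
      have h2 := hlmin hy
      simp only [vadd_eq_add, mem_singleton_iff] at *
      linarith
    calc volume K + volume L = volume (l +ᵥ K) + volume (k +ᵥ L) := by
          simp only [measure_vadd]
      _ = volume ((l +ᵥ K) ∪ (k +ᵥ L)) :=
          (measure_union₀ (hL.measurableSet.const_vadd k).nullMeasurableSet hd).symm
      _ ≤ volume (K + L) := by
          refine measure_mono (union_subset ?_ ?_)
          · rintro _ ⟨x, hx, rfl⟩
            exact ⟨x, hx, l, hl, add_comm _ _⟩
          · rintro _ ⟨y, hy, rfl⟩
            exact ⟨k, hk, y, hy, rfl⟩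
  obtain ⟨x, hx⟩ := hX0
  obtain ⟨y, hy⟩ := hY0
  rw [hX.measure_eq_iSup_isCompact, hY.measure_eq_iSup_isCompact]
  simp only [iSup_and']
  refine ENNReal.biSup_add_biSup_le' ⟨∅, by simp⟩ ⟨∅, by simp⟩ fun K hK L hL => ?_
  calc volume K + volume L ≤ volume (insert x K) + volume (insert y L) := by
        gcongr <;> exact subset_insert _ _
    _ ≤ volume (insert x K + insert y L) :=
        key _ _ (hK.2.insert x) (hL.2.insert y) (insert_nonempty _ _) (insert_nonempty _ _)
    _ ≤ volume (X + Y) :=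
        measure_mono (add_subset_add (insert_subset hx hK.1) (insert_subset hy hL.1))

theorem ENNReal.geom_mean_le_arith_mean2_weighted {s t : ℝ} (hs : 0 < s) (ht : 0 < t)
    (hst : s + t = 1) (u v : ℝ≥0∞) :
    u ^ s * v ^ t ≤ ENNReal.ofReal s * u + ENNReal.ofReal t * v := by
  rcases eq_or_ne u ⊤ with rfl | hu
  · simp [ENNReal.mul_top, hs]
  rcases eq_or_ne v ⊤ with rfl | hv
  · simp [ENNReal.mul_top, ht]
  lift u to NNReal using hu
  lift v to NNReal using hv
  have := NNReal.geom_mean_le_arith_mean2_weighted s.toNNReal t.toNNReal u v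
    (by rw [← Real.toNNReal_add hs.le ht.le, hst, Real.toNNReal_one])
  simp only [Real.coe_toNNReal _ hs.le, Real.coe_toNNReal _ ht.le] at this
  rw [← ENNReal.coe_rpow_of_nonneg _ hs.le, ← ENNReal.coe_rpow_of_nonneg _ ht.le]
  unfold ENNReal.ofReal
  exact_mod_cast this

theorem ENNReal.rpow_mul_rpow_self {s t : ℝ} (hs : 0 < s) (ht : 0 < t) (hst : s + t = 1)
    (u : ℝ≥0∞) : u ^ s * u ^ t = u := by
  rw [← ENNReal.rpow_add_of_nonneg _ _ hs.le ht.le, hst, ENNReal.rpow_one]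

/-- The Prékopa–Leindler inequality holds on `E`. -/
def PrekopaLeindler (E : Type*) [AddCommGroup E] [Module ℝ E] [MeasureSpace E] : Prop :=
  ∀ ⦃s t : ℝ⦄, 0 < s → 0 < t → s + t = 1 → ∀ ⦃f g h : E → ℝ≥0∞⦄,
    Measurable f → Measurable g → Measurable h →
    (∀ x y, f x ^ s * g y ^ t ≤ h (s • x + t • y)) →
    (∫⁻ x, f x) ^ s * (∫⁻ x, g x) ^ t ≤ ∫⁻ x, h x

theorem lintegral_eq_lintegral_meas_lt_of_le_one {α : Type*} [MeasurableSpace α]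
    (μ : Measure α) {f : α → ℝ≥0∞} (hf : Measurable f) (hf1 : ∀ x, f x ≤ 1) :
    ∫⁻ x, f x ∂μ = ∫⁻ r in Ioi (0 : ℝ), μ {x | ENNReal.ofReal r < f x} := by
  have hft : ∀ x, f x ≠ ⊤ := fun x => ((hf1 x).trans_lt one_lt_top).ne
  have := lintegral_eq_lintegral_meas_lt μ (f := fun x => (f x).toReal)
    (Eventually.of_forall fun x => toReal_nonneg) hf.ennreal_toReal.aemeasurable
  simp only [ENNReal.ofReal_toReal (hft _)] at this
  rw [this]
  refine setLIntegral_congr_fun measurableSet_Ioi fun r hr => ?_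
  simp only [ENNReal.ofReal_lt_iff_lt_toReal (le_of_lt hr) (hft _)]

theorem lintegral_add_lintegral_le_of_iSup_eq_one {s t : ℝ} (hs : 0 < s) (ht : 0 < t)
    (hst : s + t = 1) {f g h : ℝ → ℝ≥0∞} (hf : Measurable f) (hg : Measurable g)
    (hh : Measurable h) (hf1 : (⨆ x, f x) = 1) (hg1 : (⨆ x, g x) = 1)
    (H : ∀ x y, f x ^ s * g y ^ t ≤ h (s • x + t • y)) :
    ENNReal.ofReal s * (∫⁻ x, f x) + ENNReal.ofReal t * (∫⁻ x, g x) ≤ ∫⁻ x, h x := by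
  have hfle : ∀ x, f x ≤ 1 := fun x => hf1 ▸ le_iSup f x
  have hgle : ∀ x, g x ≤ 1 := fun x => hg1 ▸ le_iSup g x
  refine le_trans ?_ (lintegral_mono fun x => min_le_left (h x) 1)
  rw [lintegral_eq_lintegral_meas_lt_of_le_one _ hf hfle,
    lintegral_eq_lintegral_meas_lt_of_le_one _ hg hgle,
    lintegral_eq_lintegral_meas_lt_of_le_one _ (hh.min measurable_const)
      fun x => min_le_right _ _,
    ← lintegral_const_mul' _ _ ofReal_ne_top, ← lintegral_const_mul' _ _ ofReal_ne_top]
  refine (le_lintegral_add _ _).trans (setLIntegral_mono' measurableSet_Ioi fun r hr => ?_)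
  rcases le_or_gt 1 (ENNReal.ofReal r) with h1 | h1
  · simp [(hfle _).trans h1, (hgle _).trans h1, not_lt.2]
  have hf0 : ∀ c < 1, {x | c < f x}.Nonempty := fun c hc =>
    let ⟨x, hx⟩ := lt_iSup_iff.1 (hc.trans_eq hf1.symm)
    ⟨x, hx⟩
  have hg0 : ∀ c < 1, {x | c < g x}.Nonempty := fun c hc =>
    let ⟨x, hx⟩ := lt_iSup_iff.1 (hc.trans_eq hg1.symm)
    ⟨x, hx⟩
  have hsm : ∀ c : ℝ, 0 < c → ∀ X : Set ℝ,
      ENNReal.ofReal c * volume X = volume (c • X) := by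
    intro c hc X
    simp [Measure.addHaar_smul, abs_of_pos hc]
  rw [hsm s hs, hsm t ht]
  refine (Real.volume_add_volume_le_volume_add
    ((measurableSet_lt measurable_const hf).const_smul_of_ne_zero hs.ne')
    ((measurableSet_lt measurable_const hg).const_smul_of_ne_zero ht.ne')
    (Set.Nonempty.smul_set (hf0 _ h1))
    (Set.Nonempty.smul_set (hg0 _ h1))).trans (measure_mono ?_)
  rintro _ ⟨_, ⟨x, hx, rfl⟩, _, ⟨y, hy, rfl⟩, rfl⟩
  refine lt_min (lt_of_lt_of_le ?_ (H x y)) h1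
  rw [← ENNReal.rpow_mul_rpow_self hs ht hst (ENNReal.ofReal r)]
  exact ENNReal.mul_lt_mul (ENNReal.rpow_lt_rpow hx hs) (ENNReal.rpow_lt_rpow hy ht)

theorem prekopaLeindler_real_of_bounded {s t : ℝ} (hs : 0 < s) (ht : 0 < t)
    (hst : s + t = 1) {f g h : ℝ → ℝ≥0∞} (hf : Measurable f) (hg : Measurable g)
    (hh : Measurable h) (hfb : (⨆ x, f x) ≠ ⊤) (hgb : (⨆ x, g x) ≠ ⊤)
    (H : ∀ x y, f x ^ s * g y ^ t ≤ h (s • x + t • y)) :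
    (∫⁻ x, f x) ^ s * (∫⁻ x, g x) ^ t ≤ ∫⁻ x, h x := by
  set a := ⨆ x, f x with ha
  set b := ⨆ x, g x with hb
  rcases eq_or_ne a 0 with ha0 | ha0
  · have : f = 0 := funext fun x => le_antisymm ((le_iSup f x).trans_eq ha0) bot_le
    simp [this, hs]
  rcases eq_or_ne b 0 with hb0 | hb0
  · have : g = 0 := funext fun x => le_antisymm ((le_iSup g x).trans_eq hb0) bot_le
    simp [this, ht]
  have hc : ∀ u v : ℝ≥0∞, (u * a⁻¹) ^ s * (v * b⁻¹) ^ t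
      = (u ^ s * v ^ t) * (a ^ s * b ^ t)⁻¹ := by
    intro u v
    rw [ENNReal.mul_rpow_of_nonneg _ _ hs.le, ENNReal.mul_rpow_of_nonneg _ _ ht.le,
      ENNReal.inv_rpow, ENNReal.inv_rpow, mul_mul_mul_comm, ENNReal.mul_inv]
    · exact Or.inr (ENNReal.rpow_ne_top_of_nonneg ht.le hgb)
    · exact Or.inl (ENNReal.rpow_ne_top_of_nonneg hs.le hfb)
  have hc0 : a ^ s * b ^ t ≠ 0 := by simp [ha0, hb0, hfb, hgb, hs, ht]
  have hct : a ^ s * b ^ t ≠ ⊤ := mul_ne_top (ENNReal.rpow_ne_top_of_nonneg hs.le hfb)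
    (ENNReal.rpow_ne_top_of_nonneg ht.le hgb)
  have key := lintegral_add_lintegral_le_of_iSup_eq_one hs ht hst (hf.mul_const a⁻¹)
    (hg.mul_const b⁻¹) (hh.mul_const (a ^ s * b ^ t)⁻¹)
    (by rw [← ENNReal.iSup_mul, ← ha, ENNReal.mul_inv_cancel ha0 hfb])
    (by rw [← ENNReal.iSup_mul, ← hb, ENNReal.mul_inv_cancel hb0 hgb])
    (fun x y => by rw [hc]; gcongr; exact H x y)
  have := (ENNReal.geom_mean_le_arith_mean2_weighted hs ht hst _ _).trans key
  rw [lintegral_mul_const _ hf, lintegral_mul_const _ hg, lintegral_mul_const _ hh, hc] at this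
  exact (ENNReal.mul_le_mul_iff_left (ENNReal.inv_ne_zero.2 hct) (ENNReal.inv_ne_top.2 hc0)).1 this

theorem lintegral_eq_iSup_lintegral_min_natCast {α : Type*} [MeasurableSpace α]
    (μ : Measure α) {f : α → ℝ≥0∞} (hf : Measurable f) :
    ∫⁻ x, f x ∂μ = ⨆ n : ℕ, ∫⁻ x, min (f x) n ∂μ := by
  rw [← lintegral_iSup (fun n => hf.min measurable_const)
    fun m n hmn x => min_le_min le_rfl (Nat.cast_le.2 hmn)]
  refine lintegral_congr fun x => ?_
  rw [← inf_iSup_eq, ENNReal.iSup_natCast, inf_top_eq]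

theorem prekopaLeindler_real : PrekopaLeindler ℝ := by
  intro s t hs ht hst f g h hf hg hh H
  have hsup : ∀ {c : ℝ}, 0 < c → ∀ u : ℕ → ℝ≥0∞, (⨆ n, u n) ^ c = ⨆ n, u n ^ c :=
    fun hc u => (ENNReal.orderIsoRpow _ hc).map_iSup u
  rw [lintegral_eq_iSup_lintegral_min_natCast _ hf, lintegral_eq_iSup_lintegral_min_natCast _ hg,
    hsup hs, hsup ht, ENNReal.iSup_mul]
  refine iSup_le fun m => ?_
  rw [ENNReal.mul_iSup]
  refine iSup_le fun n => ?_
  refine prekopaLeindler_real_of_bounded hs ht hst (hf.min measurable_const)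
    (hg.min measurable_const) hh
    (ne_top_of_le_ne_top (natCast_ne_top m) (iSup_le fun x => min_le_right _ _))
    (ne_top_of_le_ne_top (natCast_ne_top n) (iSup_le fun x => min_le_right _ _))
    fun x y => le_trans ?_ (H x y)
  gcongr <;> exact min_le_left _ _

theorem PrekopaLeindler.prod {E F : Type*} [AddCommGroup E] [Module ℝ E] [MeasureSpace E]
    [AddCommGroup F] [Module ℝ F] [MeasureSpace F] [SFinite (volume : Measure E)]
    [SFinite (volume : Measure F)] (hE : PrekopaLeindler E) (hF : PrekopaLeindler F) :
    PrekopaLeindler (E × F) := by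
  intro s t hs ht hst f g h hf hg hh H
  rw [Measure.volume_eq_prod, lintegral_prod _ hf.aemeasurable, lintegral_prod _ hg.aemeasurable,
    lintegral_prod _ hh.aemeasurable]
  refine hE hs ht hst hf.lintegral_prod_right' hg.lintegral_prod_right' hh.lintegral_prod_right'
    fun x y => ?_
  exact hF hs ht hst (hf.comp measurable_prodMk_left) (hg.comp measurable_prodMk_left)
    (hh.comp measurable_prodMk_left) fun u v => H (x, u) (y, v)

theorem PrekopaLeindler.of_measurePreserving {E F : Type*} [AddCommGroup E] [Module ℝ E]
    [MeasureSpace E] [AddCommGroup F] [Module ℝ F] [MeasureSpace F] (e : E →ₗ[ℝ] F)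
    (he : MeasurePreserving e) (hE : PrekopaLeindler E) : PrekopaLeindler F := by
  intro s t hs ht hst f g h hf hg hh H
  rw [← he.lintegral_comp hf, ← he.lintegral_comp hg, ← he.lintegral_comp hh]
  refine hE hs ht hst (hf.comp he.measurable) (hg.comp he.measurable) (hh.comp he.measurable)
    fun x y => ?_
  simpa using H (e x) (e y)

theorem prekopaLeindler_fin : ∀ n : ℕ, PrekopaLeindler (Fin n → ℝ)
  | 0 => by
    intro s t hs ht hst f g h hf hg hh H
    have := H 0 0
    rw [Subsingleton.elim (s • (0 : Fin 0 → ℝ) + t • 0) 0] at this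
    simpa only [volume_pi, Measure.pi_of_empty _ 0, lintegral_dirac] using this
  | n + 1 =>
    (prekopaLeindler_real.prod (prekopaLeindler_fin n)).of_measurePreserving
      (Fin.consLinearEquiv ℝ (fun _ : Fin (n + 1) => ℝ)).toLinearMap (by
        have heq : ⇑(Fin.consLinearEquiv ℝ (fun _ : Fin (n + 1) => ℝ)).toLinearMap
            = ⇑(MeasurableEquiv.piFinSuccAbove (fun _ : Fin (n + 1) => ℝ) 0).symm := by
          funext p
          simp [MeasurableEquiv.piFinSuccAbove]
          rfl
        rw [heq]
        exact (volume_preserving_piFinSuccAbove (fun _ : Fin (n + 1) => ℝ) 0).symm)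

theorem prekopaLeindler_euclideanSpace (n : ℕ) : PrekopaLeindler (EuclideanSpace ℝ (Fin n)) :=
  (prekopaLeindler_fin n).of_measurePreserving
    (WithLp.linearEquiv 2 ℝ (Fin n → ℝ)).symm.toLinearMap (PiLp.volume_preserving_toLp (Fin n))

theorem le_volume_smul_add_smul {E : Type*} [AddCommGroup E] [Module ℝ E] [MeasureSpace E]
    (hE : PrekopaLeindler E) {s t : ℝ} (hs : 0 < s) (ht : 0 < t) (hst : s + t = 1)
    {X Y : Set E} (hX : MeasurableSet X) (hY : MeasurableSet Y) :
    volume X ^ s * volume Y ^ t ≤ volume (s • X + t • Y) := by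
  rw [← measure_toMeasurable (s • X + t • Y), ← lintegral_indicator_one hX,
    ← lintegral_indicator_one hY, ← lintegral_indicator_one (measurableSet_toMeasurable _ _)]
  refine hE hs ht hst (measurable_one.indicator hX) (measurable_one.indicator hY)
    (measurable_one.indicator (measurableSet_toMeasurable _ _)) fun x y => ?_
  by_cases hx : x ∈ X
  · by_cases hy : y ∈ Y
    · have : s • x + t • y ∈ toMeasurable volume (s • X + t • Y) :=
        subset_toMeasurable _ _ (add_mem_add (smul_mem_smul_set hx) (smul_mem_smul_set hy))
      simp [hx, hy, this]
    · simp [hy, ht]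
  · simp [hx, hs]

/-- The Brunn–Minkowski inequality, in the form of a comparison with balls. -/
theorem volume_ball_add_le_volume_add {n : ℕ} {r q : ℝ} (hr : 0 < r) (hq : 0 < q)
    {X Y : Set (EuclideanSpace ℝ (Fin n))} (hX : MeasurableSet X) (hY : MeasurableSet Y)
    (hrX : volume (Metric.ball (0 : EuclideanSpace ℝ (Fin n)) r) ≤ volume X)
    (hqY : volume (Metric.ball (0 : EuclideanSpace ℝ (Fin n)) q) ≤ volume Y) :
    volume (Metric.ball (0 : EuclideanSpace ℝ (Fin n)) (r + q)) ≤ volume (X + Y) := by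
  have key : ∀ c : ℝ, 0 < c → ∀ Z : Set (EuclideanSpace ℝ (Fin n)),
      volume (Metric.ball (0 : EuclideanSpace ℝ (Fin n)) c) ≤ volume Z →
      volume (Metric.ball (0 : EuclideanSpace ℝ (Fin n)) (r + q))
        ≤ volume (((r + q) / c) • Z) := by
    intro c hc Z hZ
    have : Metric.ball (0 : EuclideanSpace ℝ (Fin n)) (r + q)
        = ((r + q) / c) • Metric.ball (0 : EuclideanSpace ℝ (Fin n)) c := by
      rw [smul_ball (by positivity), smul_zero, Real.norm_of_nonneg (by positivity),
        div_mul_cancel₀ _ hc.ne']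
    rw [this, Measure.addHaar_smul, Measure.addHaar_smul]
    gcongr
  have hs : 0 < r / (r + q) := by positivity
  have ht : 0 < q / (r + q) := by positivity
  have hst : r / (r + q) + q / (r + q) = 1 := by field_simp
  have hcancel : ∀ c : ℝ, 0 < c → (c / (r + q)) * ((r + q) / c) = 1 := by
    intro c hc
    field_simp
  have := le_volume_smul_add_smul (prekopaLeindler_euclideanSpace n) hs ht hst
    (hX.const_smul_of_ne_zero (a := (r + q) / r) (by positivity))
    (hY.const_smul_of_ne_zero (a := (r + q) / q) (by positivity))
  rw [smul_smul, smul_smul, hcancel r hr, hcancel q hq, one_smul, one_smul] at this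
  refine le_trans ?_ this
  rw [← ENNReal.rpow_mul_rpow_self hs ht hst (volume (Metric.ball _ _))]
  exact mul_le_mul' (ENNReal.rpow_le_rpow (key r hr X hrX) hs.le)
    (ENNReal.rpow_le_rpow (key q hq Y hqY) ht.le)

theorem exists_lt_volume_ball_lt {n : ℕ} [NeZero n] {r : ℝ} (hr : 0 ≤ r) {m : ℝ≥0∞}
    (h : volume (Metric.ball (0 : Edim n) r) < m) :
    ∃ q, r < q ∧ volume (Metric.ball (0 : Edim n) q) < m := by
  have hc : Continuous fun q : ℝ =>
      ENNReal.ofReal (q ^ Module.finrank ℝ (Edim n)) * volume (Metric.ball (0 : Edim n) 1) :=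
    (ENNReal.continuous_mul_const measure_ball_lt_top.ne).comp
      (ENNReal.continuous_ofReal.comp (continuous_pow _))
  rw [Measure.addHaar_ball _ _ hr] at h
  obtain ⟨q, hq, hrq⟩ := (((hc.tendsto r).eventually_lt_const h).filter_mono
    (nhdsWithin_le_nhds (s := Ioi r)) |>.and self_mem_nhdsWithin).exists
  exact ⟨q, hrq, by rwa [Measure.addHaar_ball _ _ (hr.trans (le_of_lt hrq))]⟩

theorem volume_ball_lt_volume_ball {n : ℕ} [NeZero n] {r q : ℝ} (hr : 0 ≤ r) (hrq : r < q) :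
    volume (Metric.ball (0 : Edim n) r) < volume (Metric.ball (0 : Edim n) q) := by
  have hn : Module.finrank ℝ (Edim n) ≠ 0 := by simp [NeZero.ne n]
  rw [Measure.addHaar_ball _ _ hr, Measure.addHaar_ball _ _ (hr.trans hrq.le),
    ENNReal.mul_lt_mul_iff_left (Metric.measure_ball_pos _ _ one_pos).ne'
      measure_ball_lt_top.ne, ENNReal.ofReal_lt_ofReal_iff (pow_pos (hr.trans_lt hrq) _)]
  exact pow_lt_pow_left₀ hrq hr hn

theorem volume_setOf_volume_ball_lt_le {n : ℕ} [NeZero n] (m : ℝ≥0∞) :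
    volume {x : Edim n | volume (Metric.ball (0 : Edim n) ‖x‖) < m} ≤ m := by
  rcases eq_or_ne m ⊤ with rfl | hm
  · exact le_top
  set w := volume (Metric.ball (0 : Edim n) 1) with hw
  have hw0 : w ≠ 0 := (Metric.measure_ball_pos _ _ one_pos).ne'
  have hwt : w ≠ ⊤ := measure_ball_lt_top.ne
  have hn : (Module.finrank ℝ (Edim n)) ≠ 0 := by simp [NeZero.ne n]
  have hv : m / w ≠ ⊤ := ENNReal.div_ne_top hm hw0
  set R := (m / w).toReal ^ ((Module.finrank ℝ (Edim n) : ℝ)⁻¹) with hR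
  have hR0 : 0 ≤ R := by positivity
  have hRm : volume (Metric.ball (0 : Edim n) R) = m := by
    rw [Measure.addHaar_ball _ _ hR0, hR, Real.rpow_inv_natCast_pow toReal_nonneg hn,
      ENNReal.ofReal_toReal hv, ENNReal.div_mul_cancel hw0 hwt]
  refine (measure_mono fun x hx => ?_).trans_eq hRm
  rw [mem_ball_zero_iff]
  by_contra! hRx
  have : volume (Metric.ball (0 : Edim n) ‖x‖) < m := hx
  rw [← hRm] at this
  exact this.not_ge (measure_mono (Metric.ball_subset_ball hRx))

theorem volume_setOf_ofReal_two_mul_abs_lt_le (m : ℝ≥0∞) :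
    volume {y : ℝ | ENNReal.ofReal (2 * |y|) < m} ≤ m := by
  rcases eq_or_ne m ⊤ with rfl | hm
  · exact le_top
  calc volume {y : ℝ | ENNReal.ofReal (2 * |y|) < m}
      ≤ volume (Metric.ball (0 : ℝ) (m.toReal / 2)) := measure_mono fun y hy => by
        rw [mem_ball_zero_iff, Real.norm_eq_abs]
        have := (ENNReal.ofReal_lt_iff_lt_toReal (by positivity) hm).1 hy
        linarith
    _ = m := by rw [Real.volume_ball, mul_div_cancel₀ _ two_ne_zero, ENNReal.ofReal_toReal hm]

theorem measurable_volume_vslice {n : ℕ} {C : Set (Sp n)} (hC : MeasurableSet C) :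
    Measurable fun x => volume (vslice C x) :=
  measurable_measure_prodMk_left hC

theorem measurableSet_steiner {n : ℕ} {C : Set (Sp n)} (hC : MeasurableSet C) :
    MeasurableSet (steiner C) :=
  measurableSet_lt (by fun_prop) ((measurable_volume_vslice hC).comp measurable_fst)

theorem volume_steiner_le {n : ℕ} {C : Set (Sp n)} (hC : MeasurableSet C) :
    volume (steiner C) ≤ volume C := by
  rw [Measure.volume_eq_prod, Measure.prod_apply (measurableSet_steiner hC),
    Measure.prod_apply hC]
  exact lintegral_mono fun x => volume_setOf_ofReal_two_mul_abs_lt_le _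

theorem measurableSet_schwarz {n : ℕ} {C : Set (Sp n)} (hC : MeasurableSet C) :
    MeasurableSet (schwarz C) := by
  have hmono : Monotone fun r : ℝ => volume (Metric.ball (0 : Edim n) r) :=
    fun r q h => measure_mono (Metric.ball_subset_ball h)
  exact measurableSet_lt (hmono.measurable.comp measurable_fst.norm)
    ((measurable_measure_prodMk_right hC).comp measurable_snd)

theorem volume_schwarz_le {n : ℕ} [NeZero n] {C : Set (Sp n)} (hC : MeasurableSet C) :
    volume (schwarz C) ≤ volume C := by
  rw [Measure.volume_eq_prod, Measure.prod_apply_symm (measurableSet_schwarz hC),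
    Measure.prod_apply_symm hC]
  exact lintegral_mono fun t => volume_setOf_volume_ball_lt_le _

theorem hslice_steiner_add_subset {n : ℕ} {A B C : Set (Sp n)} (hA : MeasurableSet A)
    (hB : MeasurableSet B) (hC : A + B ⊆ C) (t u : ℝ) :
    hslice (steiner A) t + hslice (steiner B) u ⊆ hslice (steiner C) (t + u) := by
  rintro _ ⟨x, hx, y, hy, rfl⟩
  change ENNReal.ofReal (2 * |t|) < volume (vslice A x) at hx
  change ENNReal.ofReal (2 * |u|) < volume (vslice B y) at hy
  change ENNReal.ofReal (2 * |t + u|) < volume (vslice C (x + y))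
  have hsub : vslice A x + vslice B y ⊆ vslice C (x + y) := by
    rintro _ ⟨v, hv, w, hw, rfl⟩
    exact hC ⟨(x, v), hv, (y, w), hw, rfl⟩
  calc ENNReal.ofReal (2 * |t + u|) ≤ ENNReal.ofReal (2 * |t| + 2 * |u|) :=
        ENNReal.ofReal_le_ofReal (by linarith [abs_add_le t u])
    _ = ENNReal.ofReal (2 * |t|) + ENNReal.ofReal (2 * |u|) :=
        ENNReal.ofReal_add (by positivity) (by positivity)
    _ < volume (vslice A x) + volume (vslice B y) := ENNReal.add_lt_add hx hy
    _ ≤ volume (vslice A x + vslice B y) :=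
        Real.volume_add_volume_le_volume_add (measurable_prodMk_left hA)
          (measurable_prodMk_left hB)
          (nonempty_of_measure_ne_zero (bot_le.trans_lt hx).ne')
          (nonempty_of_measure_ne_zero (bot_le.trans_lt hy).ne')
    _ ≤ volume (vslice C (x + y)) := measure_mono hsub

theorem natSymm_add_natSymm_subset {n : ℕ} [NeZero n] {A B C : Set (Sp n)}
    (hA : MeasurableSet A) (hB : MeasurableSet B) (hC : A + B ⊆ C) :
    natSymm A + natSymm B ⊆ natSymm C := by
  rintro _ ⟨⟨x, t⟩, hx, ⟨y, u⟩, hy, rfl⟩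
  obtain ⟨r, hxr, hr⟩ := exists_lt_volume_ball_lt (norm_nonneg x) hx
  obtain ⟨q, hyq, hq⟩ := exists_lt_volume_ball_lt (norm_nonneg y) hy
  calc volume (Metric.ball (0 : Edim n) ‖x + y‖)
      < volume (Metric.ball (0 : Edim n) (r + q)) :=
        volume_ball_lt_volume_ball (norm_nonneg _)
          ((norm_add_le x y).trans_lt (add_lt_add hxr hyq))
    _ ≤ volume (hslice (steiner A) t + hslice (steiner B) u) :=
        volume_ball_add_le_volume_add ((norm_nonneg x).trans_lt hxr)
          ((norm_nonneg y).trans_lt hyq)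
          (measurable_prodMk_right (measurableSet_steiner hA))
          (measurable_prodMk_right (measurableSet_steiner hB)) hr.le hq.le
    _ ≤ volume (hslice (steiner C) (t + u)) :=
        measure_mono (hslice_steiner_add_subset hA hB hC t u)

/-- For Borel sets `A, B ⊆ ℝ^d` (`d ≥ 2`) of finite measure, `|A^♮ + B^♮| ≤ |A + B|`,
where `A^♮ = (A^⋆)^*`. -/
theorem natSymm_sumset_measure_le
    (d : ℕ) (hd : 2 ≤ d) (A B : Set (Sp (d-1)))
    (hA : MeasurableSet A) (hB : MeasurableSet B)
    (hAfin : volume A < ⊤) (hBfin : volume B < ⊤) :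
    volume (natSymm A + natSymm B) ≤ volume (A + B) := by
  have : NeZero (d - 1) := ⟨by omega⟩
  have hC := measurableSet_toMeasurable volume (A + B)
  calc volume (natSymm A + natSymm B)
      ≤ volume (natSymm (toMeasurable volume (A + B))) :=
        measure_mono (natSymm_add_natSymm_subset hA hB (subset_toMeasurable _ _))
    _ ≤ volume (steiner (toMeasurable volume (A + B))) :=
        volume_schwarz_le (measurableSet_steiner hC)
    _ ≤ volume (toMeasurable volume (A + B)) := volume_steiner_le hC
    _ = volume (A + B) := measure_toMeasurable _
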